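/- Let f_1, …, f_n : ℝ^d → ℝ be differentiable, convex, bounded below and L_i-smooth for symmetric positive semidefinite matrices L_i; let f = (1/n) Σ_i f_i be 𝐋-smooth for a symmetric PSD matrix 𝐋 and bounded below, with L = λmax(𝐋). Let C_1, …, C_n be mutually independent sketches of proper samplings S_i, set L̃_i = λmax(P̃_i ∘ L_i), L̃max = max_i L̃_i, and g(x) = (1/n) Σ_{i=1}^n L_i^{1/2} C_i L_i^{†1/2} ∇f_i(x). Then for all x, y ∈ ℝ^d: E[‖g(x) − ∇f(y)‖²] ≤ 2 (L + 2 L̃max / n) D_f(x, y) + (2/n) · (1/n) Σ_{i=1}^n L̃_i ‖∇f_i(y)‖²_{L_i†}, where D_f(x,y) = f(x) − f(y) − ⟨∇f(y), x − y⟩. -/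

import Mathlib

open scoped BigOperators RealInnerProductSpace
open Matrix

noncomputable section

/-- A proper sampling on `{1,…,d}`: a finitely supported probability distribution over
subsets of `Fin d` whose marginal probabilities are all positive. -/
structure Sampling (d : ℕ) where
  prob : Finset (Fin d) → ℝ
  nonneg : ∀ S, 0 ≤ prob S
  total : ∑ S : Finset (Fin d), prob S = 1
  margPos : ∀ j : Fin d, 0 < ∑ S : Finset (Fin d), if j ∈ S then prob S else 0

namespace Sampling

variable {d : ℕ} (μ : Sampling d)

/-- Marginal probability `p_j = Prob(j ∈ S)`. -/
def marg (j : Fin d) : ℝ := ∑ S : Finset (Fin d), if j ∈ S then μ.prob S else 0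

/-- Probability matrix `P`, with entries `p_{jl} = Prob({j,l} ⊆ S)`. -/
def probMatrix : Matrix (Fin d) (Fin d) ℝ :=
  Matrix.of fun j l => ∑ S : Finset (Fin d), if j ∈ S ∧ l ∈ S then μ.prob S else 0

/-- The matrix `P̄` with entries `p_{jl}/(p_j p_l)`. -/
def Pbar : Matrix (Fin d) (Fin d) ℝ :=
  Matrix.of fun j l => μ.probMatrix j l / (μ.marg j * μ.marg l)

/-- The matrix `P̃ = P̄ − E` where `E` is the all-ones matrix. -/
def Ptilde : Matrix (Fin d) (Fin d) ℝ := μ.Pbar - Matrix.of fun _ _ => (1 : ℝ)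

/-- The unbiased diagonal sketch `C` associated with a realization `S` of the sampling. -/
def sketch (S : Finset (Fin d)) : Matrix (Fin d) (Fin d) ℝ :=
  Matrix.diagonal fun j => if j ∈ S then (μ.marg j)⁻¹ else 0

end Sampling

/-- Largest eigenvalue of a symmetric matrix, via the Rayleigh quotient. -/
def lambdaMax {d : ℕ} (M : Matrix (Fin d) (Fin d) ℝ) : ℝ :=
  sSup {r : ℝ | ∃ v : Fin d → ℝ, v ⬝ᵥ v = 1 ∧ r = v ⬝ᵥ M.mulVec v}

/-- Smallest eigenvalue of a symmetric matrix, via the Rayleigh quotient. -/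
def lambdaMin {d : ℕ} (M : Matrix (Fin d) (Fin d) ℝ) : ℝ :=
  sInf {r : ℝ | ∃ v : Fin d → ℝ, v ⬝ᵥ v = 1 ∧ r = v ⬝ᵥ M.mulVec v}

/-- `Mdag` is the Moore–Penrose pseudoinverse of `M`. -/
def IsMoorePenrose {m n : Type*} [Fintype m] [Fintype n]
    (M : Matrix m n ℝ) (Mdag : Matrix n m ℝ) : Prop :=
  M * Mdag * M = M ∧ Mdag * M * Mdag = Mdag ∧
    (M * Mdag)ᵀ = M * Mdag ∧ (Mdag * M)ᵀ = Mdag * M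

/-- Vectors in `ℝ^d` with the Euclidean inner product. -/
abbrev Vec (d : ℕ) := EuclideanSpace ℝ (Fin d)

/-- Action of a matrix on a Euclidean vector. -/
def mact {d e : ℕ} (M : Matrix (Fin e) (Fin d) ℝ) (x : Vec d) : Vec e :=
  Matrix.toEuclideanLin M x

/-- Quadratic form `xᵀ M x`, i.e. the squared `M`-seminorm `‖x‖²_M`. -/
def quad {d : ℕ} (M : Matrix (Fin d) (Fin d) ℝ) (x : Vec d) : ℝ := ⟪x, mact M x⟫

/-- `f` is `M`-smooth: `f x ≤ f y + ⟨∇f(y), x−y⟩ + ½ (x−y)ᵀ M (x−y)` for all `x, y`. -/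
def MSmooth {d : ℕ} (f : Vec d → ℝ) (M : Matrix (Fin d) (Fin d) ℝ) : Prop :=
  ∀ x y : Vec d, f x ≤ f y + ⟪gradient f y, x - y⟫ + (1 / 2) * quad M (x - y)

/-- Random iterates driven by i.i.d. draws: `traj x0 step k ω` is the `k`-th iterate along
the sample path `ω` of `k` draws. -/
def traj {V Ω : Type*} (x0 : V) (step : V → Ω → V) : ∀ k : ℕ, (Fin k → Ω) → V
  | 0, _ => x0
  | k + 1, ω => step (traj x0 step k fun i => ω i.castSucc) (ω (Fin.last k))

/-- Expectation `E[φ(x^k)]` of a functional of the `k`-th iterate, over `k` i.i.d. draws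
with one-step distribution `P`. -/
def trajExp {V Ω : Type*} [Fintype Ω] (P : Ω → ℝ) (x0 : V) (step : V → Ω → V)
    (φ : V → ℝ) (k : ℕ) : ℝ :=
  ∑ ω : Fin k → Ω, (∏ i, P (ω i)) * φ (traj x0 step k ω)


section MatrixAction

variable {d : ℕ}

lemma mact_sub (M : Matrix (Fin d) (Fin d) ℝ) (x y : Vec d) :
    mact M (x - y) = mact M x - mact M y := map_sub _ _ _

lemma mact_smul (M : Matrix (Fin d) (Fin d) ℝ) (c : ℝ) (x : Vec d) :
    mact M (c • x) = c • mact M x := map_smul _ _ _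

lemma mact_mul (M N : Matrix (Fin d) (Fin d) ℝ) (x : Vec d) :
    mact (M * N) x = mact M (mact N x) := by
  simp [mact, toLpLin_mul_same]

lemma inner_mact_right (M : Matrix (Fin d) (Fin d) ℝ) (x y : Vec d) :
    ⟪x, mact M y⟫ = ⟪mact Mᵀ x, y⟫ := by
  simp only [mact, EuclideanSpace.inner_eq_star_dotProduct, toLpLin_apply, star_trivial]
  rw [dotProduct_comm, dotProduct_mulVec, dotProduct_comm, mulVec_transpose]

lemma quad_eq_dotProduct (M : Matrix (Fin d) (Fin d) ℝ) (x : Vec d) :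
    quad M x = x.ofLp ⬝ᵥ M *ᵥ x.ofLp := by
  simp only [quad, mact, EuclideanSpace.inner_eq_star_dotProduct, toLpLin_apply,
    star_trivial]
  rw [dotProduct_comm]

lemma Matrix.PosSemidef.quad_nonneg {M : Matrix (Fin d) (Fin d) ℝ} (hM : M.PosSemidef)
    (x : Vec d) : 0 ≤ quad M x := by
  rw [quad_eq_dotProduct]
  simpa using hM.dotProduct_mulVec_nonneg x.ofLp

lemma quad_smul (M : Matrix (Fin d) (Fin d) ℝ) (c : ℝ) (x : Vec d) :
    quad M (c • x) = c ^ 2 * quad M x := by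
  simp only [quad, mact_smul, inner_smul_left, inner_smul_right, conj_trivial]
  ring

lemma quad_transpose_mul_mul (M N : Matrix (Fin d) (Fin d) ℝ) (x : Vec d) :
    quad (Nᵀ * M * N) x = quad M (mact N x) := by
  rw [quad, mact_mul, mact_mul, inner_mact_right, transpose_transpose, quad]

lemma Matrix.PosSemidef.transpose_eq {M : Matrix (Fin d) (Fin d) ℝ} (hM : M.PosSemidef) :
    Mᵀ = M := by
  simpa [conjTranspose] using hM.isHermitian.eq

lemma quad_mul_self {A : Matrix (Fin d) (Fin d) ℝ} (hA : A.PosSemidef) (x : Vec d) :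
    quad (A * A) x = ‖mact A x‖ ^ 2 := by
  rw [quad, mact_mul, inner_mact_right, hA.transpose_eq, real_inner_self_eq_norm_sq]

lemma quad_sub_le {M : Matrix (Fin d) (Fin d) ℝ} (hM : M.PosSemidef) (x y : Vec d) :
    quad M x ≤ 2 * quad M (x - y) + 2 * quad M y := by
  have h := hM.quad_nonneg (x - (2 : ℝ) • y)
  have hs : ⟪y, mact M x⟫ = ⟪x, mact M y⟫ := by
    rw [inner_mact_right, hM.transpose_eq, real_inner_comm]
  simp only [quad, mact_sub, mact_smul, inner_sub_left, inner_sub_right, inner_smul_left,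
    inner_smul_right, conj_trivial] at h ⊢
  linarith

lemma bddAbove_rayleigh (M : Matrix (Fin d) (Fin d) ℝ) :
    BddAbove {r : ℝ | ∃ v : Fin d → ℝ, v ⬝ᵥ v = 1 ∧ r = v ⬝ᵥ M.mulVec v} := by
  refine ⟨‖(toEuclideanLin M).toContinuousLinearMap‖, ?_⟩
  rintro r ⟨v, hv, rfl⟩
  have hn : ‖(WithLp.toLp 2 v : Vec d)‖ = 1 := by
    have : ‖(WithLp.toLp 2 v : Vec d)‖ ^ 2 = 1 := by
      rw [← real_inner_self_eq_norm_sq, EuclideanSpace.inner_eq_star_dotProduct]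
      simpa using hv
    nlinarith [norm_nonneg (WithLp.toLp 2 v : Vec d)]
  have h1 := (toEuclideanLin M).toContinuousLinearMap.le_opNorm (WithLp.toLp 2 v)
  have h2 := real_inner_le_norm (WithLp.toLp 2 v : Vec d) (mact M (WithLp.toLp 2 v))
  have h3 : ⟪(WithLp.toLp 2 v : Vec d), mact M (WithLp.toLp 2 v)⟫ = v ⬝ᵥ M *ᵥ v :=
    quad_eq_dotProduct M (WithLp.toLp 2 v)
  rw [hn, mul_one] at h1
  rw [hn, one_mul, h3] at h2
  exact h2.trans h1

lemma quad_le_lambdaMax_mul (M : Matrix (Fin d) (Fin d) ℝ) (x : Vec d) :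
    quad M x ≤ lambdaMax M * ‖x‖ ^ 2 := by
  rcases eq_or_ne x 0 with rfl | hx
  · simp [quad]
  have hx' : 0 < ‖x‖ := norm_pos_iff.2 hx
  have h : quad M (‖x‖⁻¹ • x) ≤ lambdaMax M := by
    refine le_csSup (bddAbove_rayleigh M) ⟨(‖x‖⁻¹ • x).ofLp, ?_, quad_eq_dotProduct _ _⟩
    have := real_inner_self_eq_norm_sq (‖x‖⁻¹ • x)
    rw [norm_smul, norm_inv, norm_norm, inv_mul_cancel₀ hx'.ne',
      EuclideanSpace.inner_eq_star_dotProduct] at this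
    simpa using this
  rw [quad_smul, inv_pow, inv_mul_le_iff₀ (by positivity)] at h
  linarith

lemma lambdaMax_nonneg {M : Matrix (Fin d) (Fin d) ℝ} (hM : ∀ x : Vec d, 0 ≤ quad M x) :
    0 ≤ lambdaMax M := by
  refine Real.sSup_nonneg ?_
  rintro r ⟨v, -, rfl⟩
  exact (hM (WithLp.toLp 2 v)).trans_eq (quad_eq_dotProduct _ _)

end MatrixAction

section PseudoInverse

variable {d : ℕ}

open scoped MatrixOrder Matrix.Norms.L2Operator in
lemma Matrix.PosSemidef.eq_of_mul_self_eq {A B : Matrix (Fin d) (Fin d) ℝ}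
    (hA : A.PosSemidef) (hB : B.PosSemidef) (h : A * A = B * B) : A = B := by
  rw [← CFC.sqrt_unique h hA.nonneg, CFC.sqrt_mul_self B hB.nonneg]

/-- The square roots of a positive semidefinite matrix and of its pseudoinverse multiply to
the orthogonal projection onto the range. -/
lemma sqrt_mul_sqrt_pinv {L L' A B : Matrix (Fin d) (Fin d) ℝ} (hA : A.PosSemidef)
    (hAL : A * A = L) (hB : B.PosSemidef) (hBL : B * B = L') (h : IsMoorePenrose L L') :
    A * B = L' * L := by
  obtain ⟨h1, h2, h3, h4⟩ := h
  have hAt := hA.transpose_eq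
  have hBt := hB.transpose_eq
  have hLt : Lᵀ = L := by rw [← hAL, transpose_mul, hAt]
  have hL't : L'ᵀ = L' := by rw [← hBL, transpose_mul, hBt]
  have hcomm : L * L' = L' * L := by rw [← h3, transpose_mul, hLt, hL't]
  have hAcomm : A * L = L * A := by rw [← hAL, Matrix.mul_assoc]
  have hPA : L' * L * A = A := by
    have hz : (A - L' * L * A) * (A - L' * L * A)ᵀ = 0 := by
      rw [transpose_sub, transpose_mul, h4, hAt]
      have e1 : A * (A * (L' * L)) = L := by
        rw [← Matrix.mul_assoc, hAL, ← Matrix.mul_assoc, h1]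
      have e2 : L' * L * A * A = L := by
        rw [Matrix.mul_assoc, hAL, ← hcomm, h1]
      have e3 : L' * L * A * (A * (L' * L)) = L := by
        rw [← Matrix.mul_assoc, e2, ← Matrix.mul_assoc, h1]
      rw [Matrix.sub_mul, Matrix.mul_sub, Matrix.mul_sub, e1, e2, e3, hAL]
      simp
    have := self_mul_conjTranspose_eq_zero.1
      (show (A - L' * L * A) * (A - L' * L * A)ᴴ = 0 by
        rwa [conjTranspose_eq_transpose_of_trivial])
    exact (sub_eq_zero.1 this).symm
  have hAP : A * (L' * L) = A := by
    have := congrArg transpose hPA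
    rwa [transpose_mul, h4, hAt] at this
  have hcAL' : L' * A = A * L' := by
    calc L' * A = L' * (A * (L' * L)) := by rw [hAP]
      _ = L' * (A * L) * L' := by rw [← hcomm]; simp only [Matrix.mul_assoc]
      _ = (L' * L * A) * L' := by rw [hAcomm]; simp only [Matrix.mul_assoc]
      _ = A * L' := by rw [hPA]
  have hroot : B = L' * A := by
    refine hB.eq_of_mul_self_eq ?_ ?_
    · have hpsd : (L'ᴴ * (Aᴴ * A * A) * L').PosSemidef := by
        have h3 : (Aᴴ * A * A).PosSemidef := hA.conjTranspose_mul_mul_same A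
        exact h3.conjTranspose_mul_mul_same L'
      convert hpsd using 1
      rw [conjTranspose_eq_transpose_of_trivial, conjTranspose_eq_transpose_of_trivial, hL't,
        hAt, hAL, ← hAcomm, hAcomm, ← Matrix.mul_assoc, hPA, hcAL']
    · rw [hBL]
      nth_rewrite 2 [hcAL']
      rw [Matrix.mul_assoc, ← Matrix.mul_assoc A A, hAL, ← Matrix.mul_assoc, h2]
  rw [hroot, hcAL', ← Matrix.mul_assoc, hAL, hcomm]

end PseudoInverse

section Bregman

variable {d : ℕ} {f : Vec d → ℝ}

lemma ConvexOn.add_inner_gradient_le (hc : ConvexOn ℝ Set.univ f) (hd : Differentiable ℝ f)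
    (y z : Vec d) : f y + ⟪gradient f y, z - y⟫ ≤ f z := by
  have hconv : ConvexOn ℝ Set.univ (f ∘ AffineMap.lineMap (k := ℝ) y z) := by
    simpa using hc.comp_affineMap (AffineMap.lineMap (k := ℝ) y z)
  have hder : HasDerivAt (f ∘ AffineMap.lineMap (k := ℝ) y z) ⟪gradient f y, z - y⟫ 0 := by
    have h1 : HasFDerivAt f (fderiv ℝ f y) (AffineMap.lineMap (k := ℝ) y z 0) := by
      simpa using (hd y).hasFDerivAt
    rw [inner_gradient_left]
    exact h1.comp_hasDerivAt (0 : ℝ) AffineMap.hasDerivAt_lineMap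
  have h := hconv.le_slope_of_hasDerivAt (Set.mem_univ 0) (Set.mem_univ 1) one_pos hder
  simp only [slope_def_field, Function.comp_apply, AffineMap.lineMap_apply_one,
    AffineMap.lineMap_apply_zero, sub_zero, div_one] at h
  linarith

/-- Lower bound on the Bregman divergence of a smooth convex function by the decrease
guaranteed along the step `x - s`. -/
lemma inner_sub_half_quad_le_bregman {M : Matrix (Fin d) (Fin d) ℝ}
    (hc : ConvexOn ℝ Set.univ f) (hd : Differentiable ℝ f) (hs : MSmooth f M) (x y s : Vec d) :
    ⟪gradient f x - gradient f y, s⟫ - 1 / 2 * quad M s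
      ≤ f x - f y - ⟪gradient f y, x - y⟫ := by
  have h1 := hc.add_inner_gradient_le hd y (x - s)
  have h2 := hs (x - s) x
  have hq : quad M (x - s - x) = quad M s := by
    rw [show x - s - x = (-1 : ℝ) • s by simp, quad_smul]
    norm_num
  rw [hq] at h2
  simp only [inner_sub_left, inner_sub_right] at h1 h2 ⊢
  linarith

lemma bregman_nonneg (hc : ConvexOn ℝ Set.univ f) (hd : Differentiable ℝ f) (x y : Vec d) :
    0 ≤ f x - f y - ⟪gradient f y, x - y⟫ := by
  linarith [hc.add_inner_gradient_le hd y x]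

lemma quad_pinv_gradient_sub_le {L L' : Matrix (Fin d) (Fin d) ℝ} (hL' : L'ᵀ = L')
    (h : L' * L * L' = L') (hc : ConvexOn ℝ Set.univ f) (hd : Differentiable ℝ f)
    (hs : MSmooth f L) (x y : Vec d) :
    quad L' (gradient f x - gradient f y)
      ≤ 2 * (f x - f y - ⟪gradient f y, x - y⟫) := by
  set w := gradient f x - gradient f y with hw
  have h1 := inner_sub_half_quad_le_bregman hc hd hs x y (mact L' w)
  rw [← quad_transpose_mul_mul, hL', h, ← hw] at h1
  change quad L' w - _ ≤ _ at h1
  linarith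

lemma norm_gradient_sub_sq_le {L : Matrix (Fin d) (Fin d) ℝ} (hL : L.PosSemidef)
    (hc : ConvexOn ℝ Set.univ f) (hd : Differentiable ℝ f) (hs : MSmooth f L) (x y : Vec d) :
    ‖gradient f x - gradient f y‖ ^ 2
      ≤ 2 * lambdaMax L * (f x - f y - ⟪gradient f y, x - y⟫) := by
  set w := gradient f x - gradient f y with hw
  set D := f x - f y - ⟪gradient f y, x - y⟫ with hD
  have hl : 0 ≤ lambdaMax L := lambdaMax_nonneg hL.quad_nonneg
  have key : ∀ t : ℝ, t * ‖w‖ ^ 2 - 1 / 2 * (t ^ 2 * (lambdaMax L * ‖w‖ ^ 2)) ≤ D := by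
    intro t
    have h1 := inner_sub_half_quad_le_bregman hc hd hs x y (t • w)
    rw [quad_smul, inner_smul_right, ← hw, real_inner_self_eq_norm_sq] at h1
    have h2 := mul_le_mul_of_nonneg_left (quad_le_lambdaMax_mul L w) (sq_nonneg t)
    linarith
  rcases hl.eq_or_lt with h0 | h0
  · rw [← h0]
    by_contra! hne
    have hne' : 0 < ‖w‖ ^ 2 := by simpa using hne
    have := key ((D + 1) / ‖w‖ ^ 2)
    rw [← h0, div_mul_cancel₀ _ hne'.ne'] at this
    linarith
  · have := key (lambdaMax L)⁻¹
    have e : (lambdaMax L)⁻¹ * ‖w‖ ^ 2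
        - 1 / 2 * ((lambdaMax L)⁻¹ ^ 2 * (lambdaMax L * ‖w‖ ^ 2))
        = ‖w‖ ^ 2 / (2 * lambdaMax L) := by
      field_simp
      ring
    rw [e, div_le_iff₀ (by positivity)] at this
    linarith

/-- A smooth function that is bounded below has its gradient orthogonal to the kernel of the
smoothness matrix. -/
lemma inner_gradient_eq_zero_of_mact_eq_zero {L : Matrix (Fin d) (Fin d) ℝ}
    (hb : BddBelow (Set.range f)) (hs : MSmooth f L) (x : Vec d) {v : Vec d}
    (hv : mact L v = 0) : ⟪gradient f x, v⟫ = 0 := by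
  obtain ⟨b, hb⟩ := hb
  by_contra hne
  have h : ∀ t : ℝ, b ≤ f x + t * ⟪gradient f x, v⟫ := by
    intro t
    have h1 := hs (x + t • v) x
    have h2 : b ≤ f (x + t • v) := hb ⟨_, rfl⟩
    rw [add_sub_cancel_left, quad_smul, quad, hv, inner_zero_right, inner_smul_right] at h1
    linarith
  have := h ((b - f x - 1) / ⟪gradient f x, v⟫)
  rw [div_mul_cancel₀ _ hne] at this
  linarith

lemma mact_pinv_mul_gradient {L L' : Matrix (Fin d) (Fin d) ℝ} (h : IsMoorePenrose L L')
    (hb : BddBelow (Set.range f)) (hs : MSmooth f L) (x : Vec d) :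
    mact (L' * L) (gradient f x) = gradient f x := by
  refine ext_inner_right ℝ fun z => ?_
  have hz : mact L (z - mact (L' * L) z) = 0 := by
    rw [mact_sub, ← mact_mul, ← Matrix.mul_assoc, h.1, sub_self]
  have h0 := inner_gradient_eq_zero_of_mact_eq_zero hb hs x hz
  rw [inner_sub_right, inner_mact_right, h.2.2.2] at h0
  linarith

end Bregman

section Expectation

/-- Second moment of a shifted sum of independent centred random vectors. -/
lemma sum_prod_mul_norm_add_sum_sq {Ω V : Type*} [Fintype Ω] [NormedAddCommGroup V]
    [InnerProductSpace ℝ V] {n : ℕ} (p : Fin n → Ω → ℝ) (hp : ∀ i, ∑ s, p i s = 1)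
    (X : Fin n → Ω → V) (hX : ∀ i, ∑ s, p i s • X i s = 0) (c : V) :
    ∑ ω : Fin n → Ω, (∏ i, p i (ω i)) * ‖c + ∑ i, X i (ω i)‖ ^ 2
      = ‖c‖ ^ 2 + ∑ i, ∑ s, p i s * ‖X i s‖ ^ 2 := by
  induction n generalizing c with
  | zero => simp
  | succ n ih =>
    rw [← (Fin.consEquiv fun _ => Ω).sum_comp, Fintype.sum_prod_type]
    simp only [Fin.consEquiv_apply, Fin.prod_univ_succ, Fin.sum_univ_succ, Fin.cons_zero,
      Fin.cons_succ, mul_assoc, ← Finset.mul_sum, ← add_assoc]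
    simp only [ih (fun i => p i.succ) (fun i => hp _) (fun i => X i.succ) (fun i => hX _)]
    simp only [norm_add_sq_real,
      mul_add, Finset.sum_add_distrib, ← Finset.sum_mul, hp, one_mul]
    have h0 : ∑ s, p 0 s * (2 * ⟪c, X 0 s⟫) = 0 := by
      have := congrArg (fun v => 2 * ⟪c, v⟫) (hX 0)
      simp only [inner_sum, inner_smul_right, inner_zero_right, mul_zero, Finset.mul_sum] at this
      rw [← this]
      exact Finset.sum_congr rfl fun s _ => by ring
    rw [h0]
    ring

variable {d : ℕ} (μ : Sampling d)

namespace Sampling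

lemma marg_pos (j : Fin d) : 0 < μ.marg j := μ.margPos j

lemma sum_prob_mul_sketch_apply (j : Fin d) : ∑ S, μ.prob S * μ.sketch S j j = 1 := by
  simp only [sketch, diagonal_apply_eq, mul_ite, mul_zero, ← ite_zero_mul, ← Finset.sum_mul]
  exact mul_inv_cancel₀ (μ.marg_pos j).ne'

lemma sum_prob_mul_sketch_sub_one (j k : Fin d) :
    ∑ S, μ.prob S * ((μ.sketch S j j - 1) * (μ.sketch S k k - 1)) = μ.Ptilde j k := by
  have h : ∑ S, μ.prob S * (μ.sketch S j j * μ.sketch S k k) = μ.Pbar j k := by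
    simp only [sketch, diagonal_apply_eq, Pbar, probMatrix, of_apply, Finset.sum_div]
    refine Finset.sum_congr rfl fun S _ => ?_
    by_cases h1 : j ∈ S <;> by_cases h2 : k ∈ S <;> simp [h1, h2, div_eq_mul_inv, mul_comm]
  have e : ∀ S, μ.prob S * ((μ.sketch S j j - 1) * (μ.sketch S k k - 1))
      = μ.prob S * (μ.sketch S j j * μ.sketch S k k) - μ.prob S * μ.sketch S j j
        - μ.prob S * μ.sketch S k k + μ.prob S := fun S => by ring
  simp only [e, Finset.sum_add_distrib, Finset.sum_sub_distrib, h, sum_prob_mul_sketch_apply,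
    μ.total, Ptilde, Matrix.sub_apply, of_apply]
  ring

lemma mact_sketch_apply (S : Finset (Fin d)) (u : Vec d) (j : Fin d) :
    mact (μ.sketch S) u j = μ.sketch S j j * u j := by
  simp [mact, toLpLin_apply, sketch, mulVec_diagonal]

lemma sum_prob_smul_mact_sketch (u : Vec d) : ∑ S, μ.prob S • mact (μ.sketch S) u = u := by
  ext j
  simp only [WithLp.ofLp_sum, Finset.sum_apply, PiLp.smul_apply, smul_eq_mul, mact_sketch_apply,
    ← mul_assoc, ← Finset.sum_mul, sum_prob_mul_sketch_apply, one_mul]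

lemma sum_prob_mul_quad_sketch_sub (L : Matrix (Fin d) (Fin d) ℝ) (u : Vec d) :
    ∑ S, μ.prob S * quad L (mact (μ.sketch S) u - u) = quad (hadamard μ.Ptilde L) u := by
  simp only [quad_eq_dotProduct, dotProduct, mulVec, PiLp.sub_apply, mact_sketch_apply,
    hadamard_apply, ← sum_prob_mul_sketch_sub_one, Finset.mul_sum, Finset.sum_mul]
  rw [Finset.sum_comm]
  refine Finset.sum_congr rfl fun j _ => ?_
  rw [Finset.sum_comm]
  refine Finset.sum_congr rfl fun k _ => Finset.sum_congr rfl fun S _ => ?_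
  ring

lemma quad_hadamard_Ptilde_nonneg {L : Matrix (Fin d) (Fin d) ℝ} (hL : L.PosSemidef)
    (u : Vec d) : 0 ≤ quad (hadamard μ.Ptilde L) u := by
  rw [← sum_prob_mul_quad_sketch_sub]
  exact Finset.sum_nonneg fun S _ => mul_nonneg (μ.nonneg S) (hL.quad_nonneg _)

/-- The variance of the sketched vector `A C B v` when `A B v = v`. -/
lemma sum_prob_mul_norm_mact_sketch_sub_sq_le {A B : Matrix (Fin d) (Fin d) ℝ}
    (hA : A.PosSemidef) (hB : B.PosSemidef) {v : Vec d} (hv : mact (A * B) v = v) :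
    ∑ S, μ.prob S * ‖mact (A * μ.sketch S * B) v - v‖ ^ 2
      ≤ lambdaMax (hadamard μ.Ptilde (A * A)) * quad (B * B) v := by
  have e : ∀ S, ‖mact (A * μ.sketch S * B) v - v‖ ^ 2
      = quad (A * A) (mact (μ.sketch S) (mact B v) - mact B v) := fun S => by
    rw [quad_mul_self hA, mact_sub, ← mact_mul A B, hv, mact_mul, mact_mul]
  simp only [e, sum_prob_mul_quad_sketch_sub]
  rw [quad_mul_self hB]
  exact quad_le_lambdaMax_mul _ _

lemma sum_prob_smul_mact_sketch_sub {A B : Matrix (Fin d) (Fin d) ℝ} {v : Vec d}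
    (hv : mact (A * B) v = v) :
    ∑ S, μ.prob S • (mact (A * μ.sketch S * B) v - v) = 0 := by
  have e : ∑ S, μ.prob S • mact (A * μ.sketch S * B) v = v := by
    have := congrArg (mact A) (μ.sum_prob_smul_mact_sketch (mact B v))
    rw [← mact_mul A B, hv] at this
    nth_rewrite 2 [← this]
    simp only [mact, map_sum, map_smul, toLpLin_mul_same, LinearMap.comp_apply]
  simp only [smul_sub, Finset.sum_sub_distrib, e, ← Finset.sum_smul, μ.total, one_smul, sub_self]

end Sampling

end Expectation

lemma hasGradientAt_const_mul_sum {d n : ℕ} {fi : Fin n → Vec d → ℝ}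
    (hfi : ∀ i, Differentiable ℝ (fi i)) (c : ℝ) (x : Vec d) :
    HasGradientAt (fun x => c * ∑ i, fi i x) (c • ∑ i, gradient (fi i) x) x := by
  rw [hasGradientAt_iff_hasFDerivAt, map_smul, map_sum]
  simp only [toDual_gradient]
  exact (HasFDerivAt.fun_sum fun i _ => (hfi i x).hasFDerivAt).const_mul c

/-- second-moment bound for the sparsified gradient estimator in terms of
the Bregman divergence `D_f` and the shift `(1/n) Σ_i L̃_i ‖∇f_i(y)‖²_{L_i†}`. -/
theorem statement10 {d n : ℕ} (hn : 0 < n) (μs : Fin n → Sampling d)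
    (fi : Fin n → Vec d → ℝ) (Li Lih Lidag Lidh : Fin n → Matrix (Fin d) (Fin d) ℝ)
    (hLi : ∀ i, (Li i).PosSemidef)
    (hfi : ∀ i, Differentiable ℝ (fi i) ∧ ConvexOn ℝ Set.univ (fi i) ∧
      BddBelow (Set.range (fi i)) ∧ MSmooth (fi i) (Li i))
    (hLih : ∀ i, (Lih i).PosSemidef ∧ Lih i * Lih i = Li i)
    (hLidag : ∀ i, IsMoorePenrose (Li i) (Lidag i))
    (hLidh : ∀ i, (Lidh i).PosSemidef ∧ Lidh i * Lidh i = Lidag i)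
    (f : Vec d → ℝ) (hf : f = fun x => (1 / (n : ℝ)) * ∑ i, fi i x)
    (LL : Matrix (Fin d) (Fin d) ℝ) (hLL : LL.PosSemidef) (hfLL : MSmooth f LL)
    (hfbdd : BddBelow (Set.range f))
    (Ltilmax : ℝ) (hLtilmax : Ltilmax = ⨆ i, lambdaMax (Matrix.hadamard (μs i).Ptilde (Li i)))
    (g : Vec d → (Fin n → Finset (Fin d)) → Vec d)
    (hg : g = fun x ω => (1 / (n : ℝ)) •
      ∑ i, mact (Lih i * (μs i).sketch (ω i) * Lidh i) (gradient (fi i) x)) :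
    ∀ x y : Vec d,
      (∑ ω : Fin n → Finset (Fin d),
          (∏ i, (μs i).prob (ω i)) * ‖g x ω - gradient f y‖ ^ 2)
        ≤ 2 * (lambdaMax LL + 2 * Ltilmax / (n : ℝ))
            * (f x - f y - ⟪gradient f y, x - y⟫)
          + (2 / (n : ℝ)) * ((1 / (n : ℝ)) * ∑ i,
              lambdaMax (Matrix.hadamard (μs i).Ptilde (Li i))
                * quad (Lidag i) (gradient (fi i) y)) := by
  intro x y
  have hn' : (0 : ℝ) < n := Nat.cast_pos.2 hn
  have hd i : Differentiable ℝ (fi i) := (hfi i).1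
  have hc i : ConvexOn ℝ Set.univ (fi i) := (hfi i).2.1
  have hs i : MSmooth (fi i) (Li i) := (hfi i).2.2.2
  have hgrad z : HasGradientAt f ((1 / (n : ℝ)) • ∑ i, gradient (fi i) z) z :=
    hf ▸ hasGradientAt_const_mul_sum hd _ z
  have hfd : Differentiable ℝ f := fun z => (hgrad z).differentiableAt
  have hfc : ConvexOn ℝ Set.univ f := by
    have h : ConvexOn ℝ Set.univ (∑ i, fi i) :=
      Finset.sum_induction _ (ConvexOn ℝ Set.univ) (fun _ _ h1 h2 => h1.add h2)
        (convexOn_const 0 convex_univ) fun i _ => hc i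
    have hf' : f = fun z => (1 / (n : ℝ)) • (∑ i, fi i) z := by
      ext z
      simp [hf]
    rw [hf']
    exact h.smul (by positivity)
  set D : Fin n → ℝ := fun i => fi i x - fi i y - ⟪gradient (fi i) y, x - y⟫ with hD
  set l : Fin n → ℝ := fun i => lambdaMax (hadamard (μs i).Ptilde (Li i)) with hl
  have hl0 i : 0 ≤ l i := lambdaMax_nonneg ((μs i).quad_hadamard_Ptilde_nonneg (hLi i))
  have hlmax i : l i ≤ Ltilmax := hLtilmax ▸ le_ciSup (Set.finite_range l).bddAbove i
  have hDsum : f x - f y - ⟪gradient f y, x - y⟫ = (1 / (n : ℝ)) * ∑ i, D i := by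
    rw [(hgrad y).gradient, hf]
    simp only [hD, inner_smul_left, sum_inner, conj_trivial, Finset.sum_sub_distrib]
    ring
  have hv i : mact (Lih i * Lidh i) (gradient (fi i) x) = gradient (fi i) x := by
    rw [sqrt_mul_sqrt_pinv (hLih i).1 (hLih i).2 (hLidh i).1 (hLidh i).2 (hLidag i)]
    exact mact_pinv_mul_gradient (hLidag i) (hfi i).2.2.1 (hs i) x
  set X : Fin n → Finset (Fin d) → Vec d := fun i S => (1 / (n : ℝ)) •
    (mact (Lih i * (μs i).sketch S * Lidh i) (gradient (fi i) x) - gradient (fi i) x) with hX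
  have hXmean i : ∑ S, (μs i).prob S • X i S = 0 := by
    simp only [hX, smul_comm _ (1 / (n : ℝ)), ← Finset.smul_sum,
      (μs i).sum_prob_smul_mact_sketch_sub (hv i), smul_zero]
  have hXvar i : ∑ S, (μs i).prob S * ‖X i S‖ ^ 2
      ≤ (1 / (n : ℝ)) ^ 2 * (4 * Ltilmax * D i
        + 2 * (l i * quad (Lidag i) (gradient (fi i) y))) := by
    have h1 := (μs i).sum_prob_mul_norm_mact_sketch_sub_sq_le (hLih i).1 (hLidh i).1 (hv i)
    rw [(hLih i).2, (hLidh i).2] at h1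
    have hpsd : (Lidag i).PosSemidef := by
      rw [← (hLidh i).2]
      nth_rewrite 1 [← (hLidh i).1.isHermitian.eq]
      exact posSemidef_conjTranspose_mul_self _
    have h2 := quad_sub_le hpsd (gradient (fi i) x) (gradient (fi i) y)
    have h3 := quad_pinv_gradient_sub_le hpsd.transpose_eq (hLidag i).2.1 (hc i) (hd i) (hs i) x y
    have h4 := mul_le_mul_of_nonneg_left (h2.trans (by linarith : _ ≤ 4 * D i
      + 2 * quad (Lidag i) (gradient (fi i) y))) (hl0 i)
    have h5 := mul_le_mul_of_nonneg_right (hlmax i) (bregman_nonneg (hc i) (hd i) x y)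
    have e : ∑ S, (μs i).prob S * ‖X i S‖ ^ 2 = (1 / (n : ℝ)) ^ 2 * ∑ S, (μs i).prob S *
        ‖mact (Lih i * (μs i).sketch S * Lidh i) (gradient (fi i) x) - gradient (fi i) x‖ ^ 2 := by
      rw [Finset.mul_sum]
      refine Finset.sum_congr rfl fun S _ => ?_
      rw [hX, norm_smul, mul_pow, Real.norm_eq_abs, sq_abs]
      ring
    rw [e]
    refine mul_le_mul_of_nonneg_left ?_ (sq_nonneg _)
    linarith
  have hg' ω : g x ω - gradient f y = (gradient f x - gradient f y) + ∑ i, X i (ω i) := by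
    rw [hg, (hgrad x).gradient]
    simp only [hX, ← Finset.smul_sum, Finset.sum_sub_distrib, smul_sub]
    abel
  simp only [hg']
  rw [sum_prod_mul_norm_add_sum_sq _ (fun i => (μs i).total) X hXmean]
  refine (add_le_add (norm_gradient_sub_sq_le hLL hfc hfd hfLL x y)
    (Finset.sum_le_sum fun i _ => hXvar i)).trans_eq ?_
  rw [hDsum, ← Finset.mul_sum, Finset.sum_add_distrib, ← Finset.mul_sum, ← Finset.mul_sum]
  field_simp
  ring
end
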